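/- arXiv:1806.05529 — 2 statements merged into one kernel-verified Lean document; each statement's English description precedes it below -/
import Mathlib

section
/- For every k ≥ 2, (p−1) · dim_K(C_{L_p}(h) ∩ L_{p,k}) = dim_K L_{p,k}; that is, the fixed-point subspace of h meets the degree-k homogeneous component of L_p in a subspace of dimension dim_K L_{p,k}/(p−1). -/
namespace Paper

variable (K : Type) [Field K] (p : ℕ)

abbrev Idx (p : ℕ) : Type := (ZMod p)ˣ ⊕ (ZMod p)ˣ

/-- The Lie ideal of the free Lie algebra generated by the `v`-generators. -/
noncomputable def vIdealFree : LieIdeal K (FreeLieAlgebra K (Idx p)) :=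
  LieSubmodule.lieSpan K _ (Set.range fun i => FreeLieAlgebra.of K (Sum.inr i : Idx p))

noncomputable def rels : Set (FreeLieAlgebra K (Idx p)) :=
  { z : FreeLieAlgebra K (Idx p) | ∃ i j : (ZMod p)ˣ,
      z = ⁅FreeLieAlgebra.of K (Sum.inl i : Idx p), FreeLieAlgebra.of K (Sum.inl j : Idx p)⁆ } ∪
  { z : FreeLieAlgebra K (Idx p) | ∃ u ∈ vIdealFree K p, ∃ w ∈ vIdealFree K p, z = ⁅u, w⁆ }

noncomputable def relIdeal : LieIdeal K (FreeLieAlgebra K (Idx p)) :=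
  LieSubmodule.lieSpan K _ (rels K p)

abbrev Lp : Type := FreeLieAlgebra K (Idx p) ⧸ relIdeal K p

noncomputable def gen (x : Idx p) : Lp K p :=
  LieSubmodule.Quotient.mk (N := relIdeal K p) (FreeLieAlgebra.of K x)

noncomputable def aGen (i : (ZMod p)ˣ) : Lp K p := gen K p (Sum.inl i)
noncomputable def vGen (i : (ZMod p)ˣ) : Lp K p := gen K p (Sum.inr i)

/-- Left-normed bracket `[x, l₁, l₂, …]` in the generators. -/
noncomputable def lnb (x : Idx p) (l : List (Idx p)) : Lp K p :=
  l.foldl (fun b y => ⁅b, gen K p y⁆) (gen K p x)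

/-- Degree-`k` homogeneous component: the span of left-normed brackets of length `k`. -/
noncomputable def homog (k : ℕ) : Submodule K (Lp K p) :=
  Submodule.span K { z | ∃ x l, l.length + 1 = k ∧ z = lnb K p x l }

/-- Fixed-point subspace of a Lie algebra automorphism. -/
noncomputable def fixedSubmodule (e : Lp K p ≃ₗ⁅K⁆ Lp K p) : Submodule K (Lp K p) where
  carrier := { x | e x = x }
  add_mem' := by
    intro a b ha hb
    simp only [Set.mem_setOf_eq] at *
    rw [show e (a + b) = e a + e b from map_add e.toLinearEquiv a b, ha, hb]
  zero_mem' := by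
    simp only [Set.mem_setOf_eq]
    rw [show e 0 = 0 from map_zero e.toLinearEquiv]
  smul_mem' := by
    intro c a ha
    simp only [Set.mem_setOf_eq] at *
    rw [show e (c • a) = c • e a from map_smul e.toLinearEquiv c a, ha]

/-- Eigenspace of a Lie algebra automorphism for the eigenvalue `c`. -/
noncomputable def eigSp (e : Lp K p ≃ₗ⁅K⁆ Lp K p) (c : K) : Submodule K (Lp K p) where
  carrier := { x | e x = c • x }
  add_mem' := by
    intro a b ha hb
    simp only [Set.mem_setOf_eq] at *
    rw [show e (a + b) = e a + e b from map_add e.toLinearEquiv a b, ha, hb, smul_add]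
  zero_mem' := by
    simp only [Set.mem_setOf_eq]
    rw [show e 0 = 0 from map_zero e.toLinearEquiv, smul_zero]
  smul_mem' := by
    intro d a ha
    simp only [Set.mem_setOf_eq] at *
    rw [show e (d • a) = d • e a from map_smul e.toLinearEquiv d a, ha, smul_comm]


section LinearAlgebra

variable {K} {W G : Type*} [AddCommGroup W] [Module K W]

/-- A complete family of orthogonal projections decomposes the dimension. -/
theorem finrank_eq_sum_range [Module.Finite K W] [Fintype G] [DecidableEq G]
    (P : G → W →ₗ[K] W)
    (hP : ∀ i j x, P i (P j x) = if i = j then P j x else 0) (hsum : ∀ x, ∑ i, P i x = x) :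
    Module.finrank K W = ∑ i, Module.finrank K (LinearMap.range (P i)) := by
  rw [← Module.finrank_pi_fintype K]
  let f : W →ₗ[K] ((i : G) → LinearMap.range (P i)) := LinearMap.pi fun i => (P i).rangeRestrict
  refine LinearEquiv.finrank_eq (LinearEquiv.ofBijective f ⟨?_, ?_⟩)
  · refine (injective_iff_map_eq_zero f).2 fun x hx => ?_
    rw [← hsum x]
    exact Finset.sum_eq_zero fun i _ => congrArg Subtype.val (congrFun hx i)
  · intro y
    refine ⟨∑ j, (y j : W), ?_⟩
    funext i
    apply Subtype.ext
    have hy : ∀ j, P i (y j) = if i = j then (y j : W) else 0 := by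
      intro j
      obtain ⟨x, hx⟩ := (y j).2
      rw [← hx, hP]
    change P i (∑ j, (y j : W)) = y i
    simp [map_sum, hy]

variable [Group G] (h : W →ₗ[K] W) (P : G → W →ₗ[K] W) (r : G)

theorem iterate_intertwine (hh : ∀ i x, h (P i x) = P (r * i) (h x)) (n : ℕ) (i : G) (x : W) :
    h^[n] (P i x) = P (r ^ n * i) (h^[n] x) := by
  induction n generalizing i x with
  | zero => simp
  | succ n ih => rw [Function.iterate_succ_apply, Function.iterate_succ_apply, hh, ih, pow_succ,
      mul_assoc]

/-- If `h` cyclically permutes the summands of a decomposition indexed by the cyclic group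
`⟨r⟩` and `h ^ |r| = 1`, then the fixed points of `h` have dimension `dim W / |r|`. -/
theorem card_mul_finrank_fixed [Module.Finite K W] [Fintype G] [DecidableEq G]
    (hr : Subgroup.zpowers r = ⊤)
    (hP : ∀ i j x, P i (P j x) = if i = j then P j x else 0) (hsum : ∀ x, ∑ i, P i x = x)
    (hh : ∀ i x, h (P i x) = P (r * i) (h x)) (hord : ∀ x, h^[orderOf r] x = x) :
    Fintype.card G * Module.finrank K (LinearMap.eqLocus h LinearMap.id) =
      Module.finrank K W := by
  have hpow : ∀ g : G, ∃ n : ℕ, r ^ n = g := fun g =>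
    (mem_powers_iff_mem_zpowers.2 (hr ▸ Subgroup.mem_top g : g ∈ Subgroup.zpowers r))
  have hfix : ∀ i, Module.finrank K (LinearMap.eqLocus h LinearMap.id) =
      Module.finrank K (LinearMap.range (P i)) := by
    intro i
    let f : LinearMap.eqLocus h LinearMap.id →ₗ[K] LinearMap.range (P i) :=
      (P i).rangeRestrict ∘ₗ Submodule.subtype _
    refine LinearEquiv.finrank_eq (LinearEquiv.ofBijective f ⟨?_, ?_⟩)
    · refine (injective_iff_map_eq_zero f).2 fun x hx => ?_
      have hxi : P i x = 0 := congrArg Subtype.val hx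
      have hxf : h x = x := x.2
      apply Subtype.ext
      rw [← hsum x]
      refine Finset.sum_eq_zero fun j _ => ?_
      obtain ⟨n, hn⟩ := hpow (j * i⁻¹)
      have := iterate_intertwine h P r hh n i x
      rwa [hxi, hn, Function.iterate_fixed hxf, iterate_map_zero, inv_mul_cancel_right,
        eq_comm] at this
    · rintro ⟨_, x, rfl⟩
      have hsucc : ∀ n, h (h^[n] (P i x)) = h^[n + 1] (P i x) := fun n =>
        (Function.iterate_succ_apply' h n _).symm
      have hm : (∑ n ∈ Finset.range (orderOf r), h^[n] (P i x)) ∈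
          LinearMap.eqLocus h LinearMap.id := by
        rw [LinearMap.mem_eqLocus, map_sum, LinearMap.id_apply]
        simp only [hsucc]
        have := Finset.sum_range_succ' (fun n => h^[n] (P i x)) (orderOf r)
        rw [Finset.sum_range_succ, hord] at this
        exact (add_right_cancel this).symm
      refine ⟨⟨_, hm⟩, Subtype.ext ?_⟩
      change P i (∑ n ∈ Finset.range (orderOf r), h^[n] (P i x)) = P i x
      rw [map_sum, Finset.sum_eq_single 0]
      · simp [hP]
      · intro n hn hn0
        have hne : r ^ n ≠ 1 := fun he =>
          hn0 (Nat.eq_zero_of_dvd_of_lt (orderOf_dvd_of_pow_eq_one he) (Finset.mem_range.1 hn))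
        have hidem : P i (P i x) = P i x := by simp [hP]
        rw [← hidem, iterate_intertwine h P r hh, iterate_intertwine h P r hh, hP, if_neg]
        simpa [eq_comm] using hne
      · intro h0
        exact absurd (Finset.mem_range.2 (orderOf_pos r)) h0
  rw [finrank_eq_sum_range P hP hsum, ← Finset.card_univ, ← smul_eq_mul, ← Finset.sum_const]
  exact Finset.sum_congr rfl fun i _ => hfix i

end LinearAlgebra

section Projections

variable {K p} in
theorem lnb_induction {motive : Lp K p → Prop} (x : Idx p) (l : List (Idx p))
    (base : motive (gen K p x)) (step : ∀ b y, motive b → motive ⁅b, gen K p y⁆) :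
    motive (lnb K p x l) :=
  List.foldlRecOn (motive := motive) l _ base fun b hb y _ => step b y hb

/-- The endomorphism of the free Lie algebra that kills every `v_j` with `j ≠ i` and fixes the
other generators. -/
noncomputable def freeProj (i : (ZMod p)ˣ) :
    FreeLieAlgebra K (Idx p) →ₗ⁅K⁆ FreeLieAlgebra K (Idx p) :=
  FreeLieAlgebra.lift K (Sum.elim (fun j => FreeLieAlgebra.of K (Sum.inl j : Idx p))
    (fun j => if j = i then FreeLieAlgebra.of K (Sum.inr j : Idx p) else 0))

theorem freeProj_inl (i j : (ZMod p)ˣ) :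
    freeProj K p i (FreeLieAlgebra.of K (Sum.inl j : Idx p)) = FreeLieAlgebra.of K (Sum.inl j) := by
  simp [freeProj]

theorem freeProj_inr (i j : (ZMod p)ˣ) :
    freeProj K p i (FreeLieAlgebra.of K (Sum.inr j : Idx p)) =
      if j = i then FreeLieAlgebra.of K (Sum.inr j : Idx p) else 0 := by
  simp [freeProj]

theorem of_inr_mem_vIdealFree (j : (ZMod p)ˣ) :
    FreeLieAlgebra.of K (Sum.inr j : Idx p) ∈ vIdealFree K p :=
  LieSubmodule.subset_lieSpan ⟨j, rfl⟩

theorem freeProj_mem_vIdealFree (i : (ZMod p)ˣ) {u : FreeLieAlgebra K (Idx p)}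
    (hu : u ∈ vIdealFree K p) : freeProj K p i u ∈ vIdealFree K p := by
  have : vIdealFree K p ≤ (vIdealFree K p).comap (freeProj K p i) := by
    refine LieSubmodule.lieSpan_le.2 ?_
    rintro _ ⟨j, rfl⟩
    rw [SetLike.mem_coe, LieIdeal.mem_comap, freeProj_inr]
    split_ifs
    · exact of_inr_mem_vIdealFree K p j
    · exact zero_mem _
  exact LieIdeal.mem_comap.1 (this hu)

theorem relIdeal_le_comap_freeProj (i : (ZMod p)ˣ) :
    relIdeal K p ≤ (relIdeal K p).comap (freeProj K p i) := by
  refine LieSubmodule.lieSpan_le.2 ?_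
  rintro _ (⟨j, k, rfl⟩ | ⟨u, hu, w, hw, rfl⟩) <;>
    rw [SetLike.mem_coe, LieIdeal.mem_comap, LieHom.map_lie] <;>
    refine LieSubmodule.subset_lieSpan ?_
  · exact Or.inl ⟨j, k, by rw [freeProj_inl, freeProj_inl]⟩
  · exact Or.inr ⟨_, freeProj_mem_vIdealFree K p i hu, _, freeProj_mem_vIdealFree K p i hw, rfl⟩

/-- The endomorphism of `L_p` induced by `freeProj`. -/
noncomputable def proj (i : (ZMod p)ˣ) : Lp K p →ₗ[K] Lp K p :=
  Submodule.mapQ (relIdeal K p).toSubmodule (relIdeal K p).toSubmodule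
    (freeProj K p i : FreeLieAlgebra K (Idx p) →ₗ[K] FreeLieAlgebra K (Idx p))
    fun _ hx => LieIdeal.mem_comap.1 (relIdeal_le_comap_freeProj K p i hx)

theorem proj_mk (i : (ZMod p)ˣ) (u : FreeLieAlgebra K (Idx p)) :
    proj K p i (LieSubmodule.Quotient.mk (N := relIdeal K p) u) =
      LieSubmodule.Quotient.mk (N := relIdeal K p) (freeProj K p i u) := rfl

theorem proj_lie (i : (ZMod p)ˣ) (x y : Lp K p) :
    proj K p i ⁅x, y⁆ = ⁅proj K p i x, proj K p i y⁆ := by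
  obtain ⟨u, rfl⟩ := LieSubmodule.Quotient.surjective_mk' (relIdeal K p) x
  obtain ⟨w, rfl⟩ := LieSubmodule.Quotient.surjective_mk' (relIdeal K p) y
  change proj K p i (LieSubmodule.Quotient.mk (N := relIdeal K p) ⁅u, w⁆) = _
  rw [proj_mk, LieHom.map_lie]
  rfl

theorem proj_aGen (i j : (ZMod p)ˣ) : proj K p i (aGen K p j) = aGen K p j := by
  rw [aGen, gen, proj_mk, freeProj_inl]

theorem proj_vGen (i j : (ZMod p)ˣ) :
    proj K p i (vGen K p j) = if j = i then vGen K p j else 0 := by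
  rw [vGen, gen, proj_mk, freeProj_inr]
  split_ifs <;> rfl

theorem proj_gen (i : (ZMod p)ˣ) (y : Idx p) :
    proj K p i (gen K p y) = gen K p y ∨ proj K p i (gen K p y) = 0 := by
  rcases y with j | j
  · exact Or.inl (proj_aGen K p i j)
  · have := proj_vGen K p i j
    split_ifs at this
    · exact Or.inl this
    · exact Or.inr this

theorem proj_lnb (i : (ZMod p)ˣ) (x : Idx p) (l : List (Idx p)) :
    proj K p i (lnb K p x l) = lnb K p x l ∨ proj K p i (lnb K p x l) = 0 := by
  refine lnb_induction (motive := fun z => proj K p i z = z ∨ proj K p i z = 0) x l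
    (proj_gen K p i x) fun b y hb => ?_
  rw [proj_lie]
  rcases hb with hb | hb <;> rcases proj_gen K p i y with hy | hy <;> simp [hb, hy]

theorem proj_mem_homog (i : (ZMod p)ˣ) (k : ℕ) : ∀ z ∈ homog K p k, proj K p i z ∈ homog K p k := by
  refine fun z hz => (Submodule.span_le.2 ?_ :
    homog K p k ≤ (homog K p k).comap (proj K p i)) hz
  rintro _ ⟨x, l, hl, rfl⟩
  change proj K p i _ ∈ homog K p k
  rcases proj_lnb K p i x l with h | h <;> rw [h]
  · exact Submodule.subset_span ⟨x, l, hl, rfl⟩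
  · exact zero_mem _

theorem finite_homog (k : ℕ) : Module.Finite K (homog K p k) := by
  refine Module.Finite.span_of_finite K ?_
  refine ((Set.finite_univ (α := Idx p)).prod
    (List.finite_length_eq (Idx p) (k - 1))).image (fun q => lnb K p q.1 q.2) |>.subset ?_
  rintro _ ⟨x, l, hl, rfl⟩
  exact ⟨(x, l), ⟨trivial, by simp; omega⟩, rfl⟩

/-- The image in `L_p` of the ideal generated by the `v`-generators. -/
noncomputable def vImage : Submodule K (Lp K p) :=
  (vIdealFree K p).toSubmodule.map (relIdeal K p).toSubmodule.mkQ

theorem vGen_mem_vImage (j : (ZMod p)ˣ) : vGen K p j ∈ vImage K p :=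
  ⟨_, of_inr_mem_vIdealFree K p j, rfl⟩

theorem lie_mem_vImage {x : Lp K p} (hx : x ∈ vImage K p) (y : Lp K p) :
    ⁅x, y⁆ ∈ vImage K p := by
  obtain ⟨u, hu, rfl⟩ := hx
  obtain ⟨w, rfl⟩ := LieSubmodule.Quotient.surjective_mk' (relIdeal K p) y
  exact ⟨⁅u, w⁆, lie_mem_left K _ (vIdealFree K p) u w hu, rfl⟩

theorem lie_eq_zero_of_mem_vImage {x y : Lp K p} (hx : x ∈ vImage K p) (hy : y ∈ vImage K p) :
    ⁅x, y⁆ = 0 := by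
  obtain ⟨u, hu, rfl⟩ := hx
  obtain ⟨w, hw, rfl⟩ := hy
  exact (LieSubmodule.Quotient.mk_eq_zero (N := relIdeal K p) (m := ⁅u, w⁆)).2
    (LieSubmodule.subset_lieSpan (Or.inr ⟨u, hu, w, hw, rfl⟩))

theorem aGen_lie_aGen (i j : (ZMod p)ˣ) : ⁅aGen K p i, aGen K p j⁆ = 0 :=
  (LieSubmodule.Quotient.mk_eq_zero (N := relIdeal K p)
    (m := ⁅FreeLieAlgebra.of K (Sum.inl i : Idx p), FreeLieAlgebra.of K (Sum.inl j : Idx p)⁆)).2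
    (LieSubmodule.subset_lieSpan (Or.inl ⟨i, j, rfl⟩))

/-- The part of the `v`-ideal of `L_p` on which the `proj K p i` form a complete orthogonal
family. -/
noncomputable def splitPart [Fintype (ZMod p)ˣ] : Submodule K (Lp K p) :=
  vImage K p ⊓ LinearMap.eqLocus (∑ i, proj K p i) LinearMap.id ⊓
    ⨅ i, ⨅ j, ⨅ _ : i ≠ j, LinearMap.ker (proj K p i ∘ₗ proj K p j)

variable [Fintype (ZMod p)ˣ]

theorem mem_splitPart {z : Lp K p} : z ∈ splitPart K p ↔
    (z ∈ vImage K p ∧ ∑ i, proj K p i z = z) ∧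
      ∀ i j, i ≠ j → proj K p i (proj K p j z) = 0 := by
  simp [splitPart, LinearMap.mem_eqLocus]

theorem vGen_mem_splitPart (j : (ZMod p)ˣ) : vGen K p j ∈ splitPart K p := by
  classical
  refine (mem_splitPart K p).2 ⟨⟨vGen_mem_vImage K p j, by simp [proj_vGen]⟩, fun i k hik => ?_⟩
  rw [proj_vGen]
  split_ifs with hjk
  · rw [proj_vGen, if_neg (by rw [hjk]; exact hik.symm)]
  · exact map_zero _

theorem lie_gen_mem_splitPart {z : Lp K p} (hz : z ∈ splitPart K p) (y : Idx p) :
    ⁅z, gen K p y⁆ ∈ splitPart K p := by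
  obtain ⟨⟨hv, hs⟩, ho⟩ := (mem_splitPart K p).1 hz
  rcases y with j | j
  · change ⁅z, aGen K p j⁆ ∈ _
    refine (mem_splitPart K p).2 ⟨⟨lie_mem_vImage K p hv _, ?_⟩, fun i k hik => ?_⟩
    · simp only [proj_lie, proj_aGen]
      rw [← sum_lie, hs]
    · rw [proj_lie, proj_lie, ho i k hik, zero_lie]
  · change ⁅z, vGen K p j⁆ ∈ _
    rw [lie_eq_zero_of_mem_vImage K p hv (vGen_mem_vImage K p j)]
    exact zero_mem _

theorem foldl_lie_mem_splitPart {z : Lp K p} (hz : z ∈ splitPart K p) (l : List (Idx p)) :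
    l.foldl (fun b y => ⁅b, gen K p y⁆) z ∈ splitPart K p :=
  List.foldlRecOn l _ hz fun _ hb y _ => lie_gen_mem_splitPart K p hb y

theorem lnb_mem_splitPart (x y : Idx p) (l : List (Idx p)) :
    lnb K p x (y :: l) ∈ splitPart K p := by
  rw [lnb, List.foldl_cons]
  apply foldl_lie_mem_splitPart
  rcases x with i | i
  · rcases y with j | j
    · have h0 : ⁅gen K p (Sum.inl i), gen K p (Sum.inl j)⁆ = 0 := aGen_lie_aGen K p i j
      rw [h0]
      exact zero_mem _
    · rw [← lie_skew]
      exact neg_mem (lie_gen_mem_splitPart K p (vGen_mem_splitPart K p j) _)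
  · exact lie_gen_mem_splitPart K p (vGen_mem_splitPart K p i) y

theorem homog_le_splitPart {k : ℕ} (hk : 2 ≤ k) : homog K p k ≤ splitPart K p := by
  refine Submodule.span_le.2 ?_
  rintro _ ⟨x, l, hl, rfl⟩
  rcases l with _ | ⟨y, l⟩
  · simp at hl
    omega
  · exact lnb_mem_splitPart K p x y l

theorem proj_proj_of_mem_splitPart [DecidableEq (ZMod p)ˣ] {z : Lp K p} (hz : z ∈ splitPart K p)
    (i j : (ZMod p)ˣ) : proj K p i (proj K p j z) = if i = j then proj K p j z else 0 := by
  obtain ⟨⟨-, hs⟩, ho⟩ := (mem_splitPart K p).1 hz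
  split_ifs with hij
  · subst hij
    conv_rhs => rw [← hs, map_sum]
    exact (Finset.sum_eq_single i (fun j _ hj => ho i j hj.symm) (by simp)).symm
  · exact ho i j hij

end Projections

section Automorphism

variable {K p} {r : (ZMod p)ˣ} {h : Lp K p ≃ₗ⁅K⁆ Lp K p}

theorem map_lnb (hg : ∀ y : Idx p, h (gen K p y) = gen K p (y.map (r * ·) (r * ·)))
    (x : Idx p) (l : List (Idx p)) :
    h (lnb K p x l) = lnb K p (x.map (r * ·) (r * ·)) (l.map (Sum.map (r * ·) (r * ·))) := by
  simp only [lnb, List.foldl_map, ← hg]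
  refine (List.foldl_hom h fun b y => ?_).symm
  exact (LieEquiv.map_lie h _ _).symm

theorem iterate_map_lie (n : ℕ) (x y : Lp K p) : h^[n] ⁅x, y⁆ = ⁅h^[n] x, h^[n] y⁆ := by
  induction n generalizing x y with
  | zero => rfl
  | succ n ih => simp only [Function.iterate_succ_apply, LieEquiv.map_lie, ih]

theorem iterate_gen (hg : ∀ y : Idx p, h (gen K p y) = gen K p (y.map (r * ·) (r * ·)))
    (n : ℕ) (y : Idx p) : h^[n] (gen K p y) = gen K p (y.map (r ^ n * ·) (r ^ n * ·)) := by
  induction n generalizing y with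
  | zero => cases y <;> simp
  | succ n ih =>
    rw [Function.iterate_succ_apply, hg, ih]
    cases y <;> simp [pow_succ, mul_assoc]

theorem iterate_orderOf_lnb
    (hg : ∀ y : Idx p, h (gen K p y) = gen K p (y.map (r * ·) (r * ·)))
    (x : Idx p) (l : List (Idx p)) : h^[orderOf r] (lnb K p x l) = lnb K p x l := by
  have hg' : ∀ y, h^[orderOf r] (gen K p y) = gen K p y := fun y => by
    rw [iterate_gen hg, pow_orderOf_eq_one]
    cases y <;> simp
  refine lnb_induction (motive := fun z => h^[orderOf r] z = z) x l (hg' x) fun b y hb => ?_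
  rw [iterate_map_lie, hb, hg']

theorem map_proj_gen (hg : ∀ y : Idx p, h (gen K p y) = gen K p (y.map (r * ·) (r * ·)))
    (i : (ZMod p)ˣ) (y : Idx p) :
    h (proj K p i (gen K p y)) = proj K p (r * i) (h (gen K p y)) := by
  rw [hg]
  rcases y with j | j
  · have h1 := proj_aGen K p i j
    have h2 := proj_aGen K p (r * i) (r * j)
    simp only [aGen] at h1 h2
    rw [h1, hg, Sum.map_inl, h2]
  · have h1 := proj_vGen K p i j
    have h2 := proj_vGen K p (r * i) (r * j)
    simp only [vGen, mul_right_inj] at h1 h2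
    rw [h1, Sum.map_inr, h2]
    split_ifs
    · exact hg _
    · exact map_zero h.toLinearEquiv

theorem map_proj_lnb (hg : ∀ y : Idx p, h (gen K p y) = gen K p (y.map (r * ·) (r * ·)))
    (i : (ZMod p)ˣ) (x : Idx p) (l : List (Idx p)) :
    h (proj K p i (lnb K p x l)) = proj K p (r * i) (h (lnb K p x l)) := by
  refine lnb_induction (motive := fun z => h (proj K p i z) = proj K p (r * i) (h z)) x l
    (map_proj_gen hg i x) fun b y hb => ?_
  rw [proj_lie, LieEquiv.map_lie, LieEquiv.map_lie, proj_lie, hb, map_proj_gen hg]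

end Automorphism

/-- **Proposition 2.3.** For every `k ≥ 2`,
`(p−1) · dim (C_{L_p}(h) ∩ L_{p,k}) = dim L_{p,k}`. -/
theorem finrank_fixed_h_inter_homog (K : Type) [Field K] (p : ℕ) [Fact p.Prime]
    (hchar : ¬ (ringChar K ∣ p)) (ω : K) (hω : IsPrimitiveRoot ω p)
    (r : (ZMod p)ˣ) (hr : Subgroup.zpowers r = ⊤)
    (h : Lp K p ≃ₗ⁅K⁆ Lp K p)
    (hha : ∀ i : (ZMod p)ˣ, h (aGen K p i) = aGen K p (r * i))
    (hhv : ∀ i : (ZMod p)ˣ, h (vGen K p i) = vGen K p (r * i)) :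
    ∀ k : ℕ, 2 ≤ k →
      (p - 1) * Module.finrank K (fixedSubmodule K p h ⊓ homog K p k : Submodule K (Lp K p))
        = Module.finrank K (homog K p k) := by
  intro k hk
  classical
  have hg : ∀ y : Idx p, h (gen K p y) = gen K p (y.map (r * ·) (r * ·)) := by
    rintro (j | j)
    exacts [hha j, hhv j]
  let hl : Lp K p →ₗ[K] Lp K p := h.toLinearEquiv
  have hmem : ∀ z ∈ homog K p k, hl z ∈ homog K p k := by
    refine fun z hz => (Submodule.span_le.2 ?_ : homog K p k ≤ (homog K p k).comap hl) hz
    rintro _ ⟨x, l, hlen, rfl⟩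
    exact Submodule.subset_span ⟨_, _, by simpa using hlen, map_lnb hg x l⟩
  have hcomm : ∀ i, ∀ z ∈ homog K p k, hl (proj K p i z) = proj K p (r * i) (hl z) := by
    intro i z hz
    refine (Submodule.span_le.2 ?_ : homog K p k ≤
      LinearMap.eqLocus (hl ∘ₗ proj K p i) (proj K p (r * i) ∘ₗ hl)) hz
    rintro _ ⟨x, l, -, rfl⟩
    exact map_proj_lnb hg i x l
  have hord : ∀ z ∈ homog K p k, (hl ^ orderOf r) z = z := by
    intro z hz
    refine (Submodule.span_le.2 ?_ : homog K p k ≤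
      LinearMap.eqLocus (hl ^ orderOf r) LinearMap.id) hz
    rintro _ ⟨x, l, -, rfl⟩
    change (hl ^ orderOf r) _ = _
    rw [Module.End.pow_apply]
    exact iterate_orderOf_lnb hg x l
  have := finite_homog K p k
  have hsplit := homog_le_splitPart K p hk
  have key := card_mul_finrank_fixed (K := K) (W := homog K p k) (hl.restrict hmem)
    (fun i => (proj K p i).restrict (proj_mem_homog K p i k)) r hr
    (by
      rintro i j ⟨z, hz⟩
      apply Subtype.ext
      have := proj_proj_of_mem_splitPart K p (hsplit hz) i j
      split_ifs at this ⊢ <;> exact this)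
    (by
      rintro ⟨z, hz⟩
      apply Subtype.ext
      rw [AddSubmonoidClass.coe_finsetSum]
      exact ((mem_splitPart K p).1 (hsplit hz)).1.2)
    (by
      rintro i ⟨z, hz⟩
      exact Subtype.ext (hcomm i z hz))
    (by
      rintro ⟨z, hz⟩
      rw [← Module.End.pow_apply, Module.End.pow_restrict]
      exact Subtype.ext (hord z hz))
  have hfixed : LinearMap.eqLocus (hl.restrict hmem) LinearMap.id =
      (fixedSubmodule K p h).comap (homog K p k).subtype := by
    ext z
    exact Subtype.ext_iff
  rw [ZMod.card_units, hfixed, ← Submodule.finrank_map_subtype_eq, Submodule.map_comap_subtype,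
    inf_comm] at key
  exact key

end Paper
end

section
/- The ideal I_p intersects L_{p,1} trivially, and for every k ≥ 2 one has dim_K(I_p ∩ L_{p,k}) ≤ (k−1)(p−1)^{k−1}. -/
namespace Paper

variable (K : Type) [Field K] (p : ℕ)

/-- The Lie ideal of `L_p` generated by the fixed-point subspace of `f`. -/
noncomputable def Ip (K : Type) [Field K] (p : ℕ) (f : Lp K p ≃ₗ⁅K⁆ Lp K p) :
    LieIdeal K (Lp K p) :=
  LieSubmodule.lieSpan K (Lp K p) (fixedSubmodule K p f : Set (Lp K p))

section Grading

open scoped TensorProduct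

variable {K p}

/-- The quotient map onto `L_p`, as a morphism of Lie algebras. -/
noncomputable def quotHom : FreeLieAlgebra K (Idx p) →ₗ⁅K⁆ Lp K p :=
  { (relIdeal K p).toSubmodule.mkQ with map_lie' := rfl }

theorem quotHom_of (x : Idx p) : quotHom (FreeLieAlgebra.of K x) = gen K p x := rfl

theorem quotHom_surjective : Function.Surjective (quotHom : _ → Lp K p) :=
  Submodule.mkQ_surjective _

theorem quotHom_eq_zero {z : FreeLieAlgebra K (Idx p)} (hz : z ∈ rels K p) :
    quotHom z = 0 :=
  (Submodule.Quotient.mk_eq_zero _).2 (LieSubmodule.subset_lieSpan hz)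

theorem lieSubalgebra_eq_top (N : LieSubalgebra K (Lp K p)) (hN : ∀ x, gen K p x ∈ N) :
    N = ⊤ := by
  refine eq_top_iff.2 fun z _ => ?_
  obtain ⟨y, rfl⟩ := quotHom_surjective z
  have h : N.incl.comp (FreeLieAlgebra.lift K fun x => (⟨gen K p x, hN x⟩ : N)) = quotHom :=
    FreeLieAlgebra.hom_ext fun x => by simp [quotHom_of]
  rw [← h]
  exact Subtype.mem _

/-- A subspace stable under bracketing with the generators is stable under all of `L_p`. -/
theorem lie_mem_of_forall_gen (T : Submodule K (Lp K p))
    (hT : ∀ x, ∀ t ∈ T, ⁅t, gen K p x⁆ ∈ T) (x t : Lp K p) (ht : t ∈ T) : ⁅x, t⁆ ∈ T := by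
  let N : LieSubalgebra K (Lp K p) :=
    { carrier := {x | ∀ t ∈ T, ⁅x, t⁆ ∈ T}
      add_mem' := fun ha hb t ht => by rw [add_lie]; exact T.add_mem (ha t ht) (hb t ht)
      zero_mem' := fun t _ => by rw [zero_lie]; exact T.zero_mem
      smul_mem' := fun c _ ha t ht => by rw [smul_lie]; exact T.smul_mem c (ha t ht)
      lie_mem' := fun {a b} ha hb t ht => by
        rw [lie_lie]; exact T.sub_mem (ha _ (hb t ht)) (hb _ (ha t ht)) }
  have hN : N = ⊤ := lieSubalgebra_eq_top N fun x t ht => by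
    rw [← lie_skew]; exact T.neg_mem (hT x t ht)
  have hx : x ∈ N := hN ▸ LieSubalgebra.mem_top x
  exact hx t ht

variable (K p) in
/-- The Lie ideal of `L_p` generated by the `v`-generators. -/
noncomputable def vIdeal : LieIdeal K (Lp K p) := (vIdealFree K p).map quotHom

theorem quotHom_mem_vIdeal {u : FreeLieAlgebra K (Idx p)} (hu : u ∈ vIdealFree K p) :
    quotHom u ∈ vIdeal K p := LieIdeal.mem_map hu

theorem vGen_mem_vIdeal (i : (ZMod p)ˣ) : gen K p (Sum.inr i) ∈ vIdeal K p :=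
  quotHom_mem_vIdeal (LieSubmodule.subset_lieSpan ⟨i, rfl⟩)

theorem lie_vIdeal_vIdeal : ⁅vIdeal K p, vIdeal K p⁆ = ⊥ := by
  rw [LieSubmodule.lie_eq_bot_iff]
  intro x hx y hy
  obtain ⟨⟨u, hu⟩, rfl⟩ := LieIdeal.mem_map_of_surjective quotHom_surjective hx
  obtain ⟨⟨w, hw⟩, rfl⟩ := LieIdeal.mem_map_of_surjective quotHom_surjective hy
  rw [← LieHom.map_lie]
  exact quotHom_eq_zero (Or.inr ⟨u, hu, w, hw, rfl⟩)

theorem lie_eq_zero_of_mem_vIdeal {x y : Lp K p} (hx : x ∈ vIdeal K p) (hy : y ∈ vIdeal K p) :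
    ⁅x, y⁆ = 0 :=
  (LieSubmodule.lie_eq_bot_iff _ _).1 lie_vIdeal_vIdeal x hx y hy

theorem lie_aGen_aGen (i j : (ZMod p)ˣ) :
    ⁅gen K p (Sum.inl i), gen K p (Sum.inl j)⁆ = 0 := by
  rw [← quotHom_of, ← quotHom_of, ← LieHom.map_lie]
  exact quotHom_eq_zero (Or.inl ⟨i, j, rfl⟩)

variable (K p) in
/-- The morphism from the free Lie algebra to `K[X] ⊗ L_p` multiplying each generator by `X`. -/
noncomputable def freeGradingHom :
    FreeLieAlgebra K (Idx p) →ₗ⁅K⁆ Polynomial K ⊗[K] Lp K p :=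
  FreeLieAlgebra.lift K fun x => Polynomial.X ⊗ₜ[K] gen K p x

theorem freeGradingHom_of (x : Idx p) :
    freeGradingHom K p (FreeLieAlgebra.of K x) = Polynomial.X ⊗ₜ[K] gen K p x :=
  FreeLieAlgebra.lift_of_apply ..

theorem freeGradingHom_mem_baseChange {u : FreeLieAlgebra K (Idx p)} (hu : u ∈ vIdealFree K p) :
    freeGradingHom K p u ∈ (vIdeal K p).baseChange (Polynomial K) := by
  let J : LieIdeal K (FreeLieAlgebra K (Idx p)) :=
    { ((((vIdeal K p).baseChange (Polynomial K)).toSubmodule).restrictScalars K).comap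
        (freeGradingHom K p : _ →ₗ[K] _) with
      lie_mem := fun {x m} hm => by
        change freeGradingHom K p ⁅x, m⁆ ∈ (vIdeal K p).baseChange (Polynomial K)
        rw [LieHom.map_lie]
        exact LieSubmodule.lie_mem _ hm }
  have hJ : vIdealFree K p ≤ J := by
    refine LieSubmodule.lieSpan_le.2 ?_
    rintro _ ⟨i, rfl⟩
    change freeGradingHom K p _ ∈ (vIdeal K p).baseChange (Polynomial K)
    rw [freeGradingHom_of]
    exact LieSubmodule.tmul_mem_baseChange_of_mem _ (vGen_mem_vIdeal i)
  exact hJ hu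

theorem relIdeal_le_ker_freeGradingHom : relIdeal K p ≤ (freeGradingHom K p).ker := by
  refine LieSubmodule.lieSpan_le.2 ?_
  rintro _ (⟨i, j, rfl⟩ | ⟨u, hu, w, hw, rfl⟩)
  · simp [LieHom.mem_ker, freeGradingHom_of, LieAlgebra.ExtendScalars.bracket_tmul, lie_aGen_aGen]
  · rw [SetLike.mem_coe, LieHom.mem_ker, LieHom.map_lie]
    have h : ⁅(vIdeal K p).baseChange (Polynomial K), (vIdeal K p).baseChange (Polynomial K)⁆
        = ⊥ := by
      rw [← LieSubmodule.lie_baseChange, lie_vIdeal_vIdeal, LieSubmodule.baseChange_bot]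
    exact (LieSubmodule.lie_eq_bot_iff _ _).1 h _ (freeGradingHom_mem_baseChange hu) _
      (freeGradingHom_mem_baseChange hw)

variable (K p) in
/-- The morphism `L_p → K[X] ⊗ L_p` multiplying each generator by `X`. -/
noncomputable def gradingHom : Lp K p →ₗ⁅K⁆ Polynomial K ⊗[K] Lp K p :=
  { (relIdeal K p).toSubmodule.liftQ (freeGradingHom K p : _ →ₗ[K] _)
      relIdeal_le_ker_freeGradingHom with
    map_lie' := fun {x y} => by
      obtain ⟨x, rfl⟩ := quotHom_surjective x
      obtain ⟨y, rfl⟩ := quotHom_surjective y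
      exact LieHom.map_lie (freeGradingHom K p) x y }

theorem gradingHom_gen (x : Idx p) :
    gradingHom K p (gen K p x) = Polynomial.X ⊗ₜ[K] gen K p x :=
  freeGradingHom_of x

theorem lnb_append_singleton (x y : Idx p) (l : List (Idx p)) :
    lnb K p x (l ++ [y]) = ⁅lnb K p x l, gen K p y⁆ := by
  simp [lnb]

theorem gradingHom_lnb (x : Idx p) (l : List (Idx p)) :
    gradingHom K p (lnb K p x l) = (Polynomial.X ^ (l.length + 1)) ⊗ₜ[K] lnb K p x l := by
  induction l using List.reverseRecOn with
  | nil => simpa [lnb] using gradingHom_gen x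
  | append_singleton l y ih =>
    rw [lnb_append_singleton, LieHom.map_lie, ih, gradingHom_gen,
      LieAlgebra.ExtendScalars.bracket_tmul, ← pow_succ]
    simp

variable (K p) in
/-- The projection of `L_p` onto its degree-`k` component. -/
noncomputable def homogProj (k : ℕ) : Lp K p →ₗ[K] Lp K p :=
  (TensorProduct.lid K (Lp K p)).toLinearMap ∘ₗ
    (Polynomial.lcoeff K k).rTensor (Lp K p) ∘ₗ (gradingHom K p : _ →ₗ[K] _)

theorem homogProj_lnb (k : ℕ) (x : Idx p) (l : List (Idx p)) :
    homogProj K p k (lnb K p x l) = if l.length + 1 = k then lnb K p x l else 0 := by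
  have h : homogProj K p k (lnb K p x l) = TensorProduct.lid K (Lp K p)
    ((Polynomial.lcoeff K k).rTensor (Lp K p) (gradingHom K p (lnb K p x l))) := rfl
  rw [h, gradingHom_lnb]
  simp [Polynomial.coeff_X_pow, eq_comm]

theorem homogProj_of_mem_homog {k : ℕ} {z : Lp K p} (hz : z ∈ homog K p k) :
    homogProj K p k z = z := by
  induction hz using Submodule.span_induction with
  | mem z hz => obtain ⟨x, l, hl, rfl⟩ := hz; rw [homogProj_lnb, if_pos hl]
  | zero => simp
  | add a b _ _ ha hb => rw [map_add, ha, hb]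
  | smul c a _ ha => rw [map_smul, ha]

end Grading

section Spanning

variable {K p}

variable (K) in
/-- The bracket `[v_j, a_{i₁}, a_{i₂}, …]`. -/
noncomputable def vaBracket (j : (ZMod p)ˣ) (l : List (ZMod p)ˣ) : Lp K p :=
  lnb K p (Sum.inr j) (l.map Sum.inl)

theorem vaBracket_nil (j : (ZMod p)ˣ) : vaBracket K j [] = gen K p (Sum.inr j) := rfl

theorem vaBracket_append_singleton (j i : (ZMod p)ˣ) (l : List (ZMod p)ˣ) :
    vaBracket K j (l ++ [i]) = ⁅vaBracket K j l, gen K p (Sum.inl i)⁆ := by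
  simp [vaBracket, lnb_append_singleton]

theorem vaBracket_mem_vIdeal (j : (ZMod p)ˣ) (l : List (ZMod p)ˣ) :
    vaBracket K j l ∈ vIdeal K p := by
  induction l using List.reverseRecOn with
  | nil => exact vGen_mem_vIdeal j
  | append_singleton l i ih =>
    rw [vaBracket_append_singleton]
    exact lie_mem_left K (Lp K p) (vIdeal K p) _ _ ih

theorem lie_vaBracket_vGen (j i : (ZMod p)ˣ) (l : List (ZMod p)ˣ) :
    ⁅vaBracket K j l, gen K p (Sum.inr i)⁆ = 0 :=
  lie_eq_zero_of_mem_vIdeal (vaBracket_mem_vIdeal j l) (vGen_mem_vIdeal i)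

variable (K p) in
/-- The elements `a_i` and `[v_j, a_{i₁}, a_{i₂}, …]`. -/
def monomials : Set (Lp K p) :=
  Set.range (aGen K p) ∪ Set.range fun w : (ZMod p)ˣ × List (ZMod p)ˣ => vaBracket K w.1 w.2

theorem gen_mem_span_monomials (x : Idx p) :
    gen K p x ∈ Submodule.span K (monomials K p) := by
  rcases x with i | i
  · exact Submodule.subset_span (Or.inl ⟨i, rfl⟩)
  · exact Submodule.subset_span (Or.inr ⟨(i, []), rfl⟩)

theorem span_lie_gen_mem {S : Set (Lp K p)} {x : Idx p}
    (hS : ∀ s ∈ S, ⁅s, gen K p x⁆ ∈ Submodule.span K S) :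
    ∀ t ∈ Submodule.span K S, ⁅t, gen K p x⁆ ∈ Submodule.span K S := by
  intro t ht
  induction ht using Submodule.span_induction with
  | mem s hs => exact hS s hs
  | zero => simp
  | add a b _ _ ha hb => rw [add_lie]; exact Submodule.add_mem _ ha hb
  | smul c a _ ha => rw [smul_lie]; exact Submodule.smul_mem _ c ha

theorem span_monomials : Submodule.span K (monomials K p) = ⊤ := by
  have hlie := lie_mem_of_forall_gen (Submodule.span K (monomials K p)) fun x =>
    span_lie_gen_mem <| by
      rintro _ (⟨i, rfl⟩ | ⟨⟨j, l⟩, rfl⟩) <;> rcases x with h | h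
      · rw [aGen, lie_aGen_aGen]; exact Submodule.zero_mem _
      · rw [← lie_skew]
        refine Submodule.neg_mem _ (Submodule.subset_span (Or.inr ⟨(h, [i]), ?_⟩))
        exact vaBracket_append_singleton h i []
      · exact Submodule.subset_span
          (Or.inr ⟨(j, l ++ [h]), vaBracket_append_singleton j h l⟩)
      · rw [lie_vaBracket_vGen]; exact Submodule.zero_mem _
  let N : LieSubalgebra K (Lp K p) :=
    { Submodule.span K (monomials K p) with lie_mem' := fun {a b} _ hb => hlie a b hb }
  have hN : N = ⊤ := lieSubalgebra_eq_top N gen_mem_span_monomials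
  refine eq_top_iff.2 fun x _ => ?_
  have hx : x ∈ N := hN ▸ LieSubalgebra.mem_top x
  exact hx

/-- A fixed vector of an endomorphism is a combination of the fixed vectors in any spanning set
of eigenvectors. -/
theorem mem_span_fixed_of_map_eq {V : Type*} [AddCommGroup V] [Module K V] (g : Module.End K V)
    {S : Set V} (hS : Submodule.span K S = ⊤) (hg : ∀ s ∈ S, ∃ c : K, g s = c • s)
    {x : V} (hx : g x = x) : x ∈ Submodule.span K {s ∈ S | g s = s} := by
  have hsub : Submodule.span K S ≤ Submodule.span K {s ∈ S | g s = s} ⊔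
      ⨆ (c : K) (_ : c ≠ 1), g.eigenspace c := by
    refine Submodule.span_le.2 fun s hs => ?_
    by_cases h : g s = s
    · exact Submodule.mem_sup_left (Submodule.subset_span ⟨hs, h⟩)
    · obtain ⟨c, hc⟩ := hg s hs
      refine Submodule.mem_sup_right (Submodule.mem_iSup_of_mem c (Submodule.mem_iSup_of_mem ?_
        (Module.End.mem_eigenspace_iff.2 hc)))
      rintro rfl
      exact h (by rw [hc, one_smul])
  have hxtop : x ∈ Submodule.span K S := hS ▸ Submodule.mem_top
  obtain ⟨y, hy, z, hz, rfl⟩ := Submodule.mem_sup.1 (hsub hxtop)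
  have hgy : g y = y := by
    have hle : Submodule.span K {s ∈ S | g s = s} ≤ LinearMap.eqLocus g LinearMap.id :=
      Submodule.span_le.2 fun s hs => hs.2
    exact hle hy
  have hgz : g z = z := by
    rw [map_add, hgy] at hx
    exact add_left_cancel hx
  have hz1 : z ∈ g.eigenspace 1 := Module.End.mem_eigenspace_iff.2 (by rw [hgz, one_smul])
  have hz0 : z = 0 := (Submodule.disjoint_def.1 (g.eigenspaces_iSupIndep 1)) z hz1 hz
  rwa [hz0, add_zero]

/-- The brackets `[v_j, a_{i₁}, …, a_{i_n}]` with `j + i₁ + ⋯ + i_t = 0` for some `1 ≤ t ≤ n`. -/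
def zeroPrefixSet (K : Type) [Field K] (p : ℕ) : Set (Lp K p) :=
  {z | ∃ (j : (ZMod p)ˣ) (m : List (ZMod p)ˣ) (i : (ZMod p)ˣ) (l : List (ZMod p)ˣ),
    (j : ZMod p) + (m.map Units.val).sum + i = 0 ∧ z = vaBracket K j (m ++ i :: l)}

theorem lie_mem_span_zeroPrefixSet (x t : Lp K p)
    (ht : t ∈ Submodule.span K (zeroPrefixSet K p)) :
    ⁅x, t⁆ ∈ Submodule.span K (zeroPrefixSet K p) := by
  refine lie_mem_of_forall_gen _ (fun x => span_lie_gen_mem ?_) x t ht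
  rintro _ ⟨j, m, i, l, h0, rfl⟩
  rcases x with h | h
  · refine Submodule.subset_span ⟨j, m, i, l ++ [h], h0, ?_⟩
    rw [← vaBracket_append_singleton]
    simp
  · rw [lie_vaBracket_vGen]; exact Submodule.zero_mem _

theorem map_vaBracket {ω : K} {f : Lp K p ≃ₗ⁅K⁆ Lp K p}
    (hfa : ∀ i : (ZMod p)ˣ, f (aGen K p i) = ω ^ ((i : ZMod p)).val • aGen K p i)
    (hfv : ∀ i : (ZMod p)ˣ, f (vGen K p i) = ω ^ ((i : ZMod p)).val • vGen K p i)
    (j : (ZMod p)ˣ) (l : List (ZMod p)ˣ) :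
    f (vaBracket K j l) =
      ω ^ ((j : ZMod p).val + (l.map fun i : (ZMod p)ˣ => (i : ZMod p).val).sum) • vaBracket K j l := by
  induction l using List.reverseRecOn with
  | nil => rw [List.map_nil, List.sum_nil, add_zero]; exact hfv j
  | append_singleton l i ih =>
    have hi : f (gen K p (Sum.inl i)) = _ • gen K p (Sum.inl i) := hfa i
    rw [vaBracket_append_singleton, LieEquiv.map_lie, ih, hi, smul_lie, lie_smul, smul_smul,
      ← pow_add]
    simp [add_assoc]

variable (K p) in
/-- The elements of `zeroPrefixSet` given by words of length `n + 1`. -/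
def zeroPrefixSetOfLength (n : ℕ) : Set (Lp K p) :=
  {z | ∃ (j : (ZMod p)ˣ) (m : List (ZMod p)ˣ) (i : (ZMod p)ˣ) (l : List (ZMod p)ˣ),
    (j : ZMod p) + (m.map Units.val).sum + i = 0 ∧ (j :: m ++ l).length = n ∧
    z = vaBracket K j (m ++ i :: l)}

theorem span_zeroPrefixSet_inf_homog_le (n : ℕ) :
    Submodule.span K (zeroPrefixSet K p) ⊓ homog K p (n + 1) ≤
      Submodule.span K (zeroPrefixSetOfLength K p n) := by
  rintro z ⟨hz, hzn⟩
  rw [← homogProj_of_mem_homog hzn]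
  have hle : Submodule.span K (zeroPrefixSet K p) ≤
      (Submodule.span K (zeroPrefixSetOfLength K p n)).comap (homogProj K p (n + 1)) := by
    refine Submodule.span_le.2 ?_
    rintro _ ⟨j, m, i, l, h0, rfl⟩
    rw [SetLike.mem_coe, Submodule.mem_comap, vaBracket, homogProj_lnb]
    split_ifs with h
    · refine Submodule.subset_span ⟨j, m, i, l, h0, ?_, rfl⟩
      simp at h ⊢
      omega
    · exact Submodule.zero_mem _
  exact hle hz

variable [Fact p.Prime]

theorem vaBracket_mem_of_sum_eq_zero {j : (ZMod p)ˣ} {l : List (ZMod p)ˣ}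
    (h : (j : ZMod p) + (l.map Units.val).sum = 0) : vaBracket K j l ∈ zeroPrefixSet K p := by
  rcases List.eq_nil_or_concat' l with rfl | ⟨m, i, rfl⟩
  · simp at h
  · exact ⟨j, m, i, [], by simpa [add_assoc] using h, rfl⟩

theorem fixedSubmodule_le {ω : K} (hω : IsPrimitiveRoot ω p) {f : Lp K p ≃ₗ⁅K⁆ Lp K p}
    (hfa : ∀ i : (ZMod p)ˣ, f (aGen K p i) = ω ^ ((i : ZMod p)).val • aGen K p i)
    (hfv : ∀ i : (ZMod p)ˣ, f (vGen K p i) = ω ^ ((i : ZMod p)).val • vGen K p i) :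
    fixedSubmodule K p f ≤ Submodule.span K (zeroPrefixSet K p) := by
  intro x hx
  have hspan := mem_span_fixed_of_map_eq (f.toLinearEquiv : Lp K p →ₗ[K] Lp K p) span_monomials
    (by
      rintro _ (⟨i, rfl⟩ | ⟨⟨j, l⟩, rfl⟩)
      · exact ⟨_, hfa i⟩
      · exact ⟨_, map_vaBracket hfa hfv j l⟩) hx
  have key : ∀ (n : ℕ) (s : Lp K p), f s = ω ^ n • s → f s = s → s ≠ 0 → (n : ZMod p) = 0 := by
    intro n s hn hs h0
    rw [hs, eq_comm] at hn
    have h1 : (ω ^ n - 1) • s = 0 := by rw [sub_smul, hn, one_smul, sub_self]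
    have h2 : ω ^ n = 1 := sub_eq_zero.1 ((smul_eq_zero.1 h1).resolve_right h0)
    exact (ZMod.natCast_eq_zero_iff n p).2 (hω.dvd_of_pow_eq_one n h2)
  refine Submodule.span_le.2 ?_ hspan
  rintro s ⟨hs, hfs⟩
  by_cases h0 : s = 0
  · rw [h0]; exact Submodule.zero_mem _
  rcases hs with ⟨i, rfl⟩ | ⟨⟨j, l⟩, rfl⟩
  · have := key _ _ (hfa i) hfs h0
    rw [ZMod.natCast_zmod_val] at this
    exact absurd this i.ne_zero
  · have := key _ _ (map_vaBracket hfa hfv j l) hfs h0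
    refine Submodule.subset_span (vaBracket_mem_of_sum_eq_zero ?_)
    simpa [Nat.cast_list_sum, Function.comp_def] using this

theorem Ip_le {ω : K} (hω : IsPrimitiveRoot ω p) {f : Lp K p ≃ₗ⁅K⁆ Lp K p}
    (hfa : ∀ i : (ZMod p)ˣ, f (aGen K p i) = ω ^ ((i : ZMod p)).val • aGen K p i)
    (hfv : ∀ i : (ZMod p)ˣ, f (vGen K p i) = ω ^ ((i : ZMod p)).val • vGen K p i) :
    (Ip K p f).toSubmodule ≤ Submodule.span K (zeroPrefixSet K p) := by
  let J : LieIdeal K (Lp K p) :=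
    { Submodule.span K (zeroPrefixSet K p) with
      lie_mem := fun {x t} ht => lie_mem_span_zeroPrefixSet x t ht }
  have h : Ip K p f ≤ J := LieSubmodule.lieSpan_le.2 (fixedSubmodule_le hω hfa hfv)
  exact h

theorem mk_zeroPrefixSetOfLength_le (n : ℕ) :
    Cardinal.mk (zeroPrefixSetOfLength K p n) ≤ ((n * (p - 1) ^ n : ℕ) : Cardinal) := by
  choose j m i l h0 hn hz using fun z : zeroPrefixSetOfLength K p n => z.2
  let F : zeroPrefixSetOfLength K p n → Fin n × List.Vector (ZMod p)ˣ n := fun z =>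
    (⟨(m z).length, by have := hn z; simp at this; omega⟩, ⟨j z :: m z ++ l z, hn z⟩)
  have hF : Function.Injective F := by
    intro z w hzw
    obtain ⟨hlen, hword⟩ := Prod.mk.inj hzw
    obtain ⟨hj, hml⟩ := List.cons.inj (congrArg Subtype.val hword)
    obtain ⟨hm, hl⟩ := List.append_inj hml (congrArg Fin.val hlen)
    have hi : i z = i w := by
      have h1 := h0 z
      rw [hj, hm, ← h0 w] at h1
      exact Units.ext (add_left_cancel h1)
    exact Subtype.ext (by rw [hz z, hz w, hj, hm, hi, hl])
  refine (Cardinal.mk_le_of_injective hF).trans (le_of_eq ?_)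
  rw [Cardinal.mk_fintype, Fintype.card_prod, Fintype.card_fin, card_vector, ZMod.card_units]

end Spanning

/-- **Proposition 3.1.** `I_p ∩ L_{p,1} = 0` and
`dim (I_p ∩ L_{p,k}) ≤ (k−1)(p−1)^{k−1}` for all `k ≥ 2`. -/
theorem rank_Ip_inter_homog (K : Type) [Field K] (p : ℕ) [Fact p.Prime]
    (hchar : ¬ (ringChar K ∣ p)) (ω : K) (hω : IsPrimitiveRoot ω p)
    (f : Lp K p ≃ₗ⁅K⁆ Lp K p)
    (hfa : ∀ i : (ZMod p)ˣ, f (aGen K p i) = ω ^ ((i : ZMod p)).val • aGen K p i)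
    (hfv : ∀ i : (ZMod p)ˣ, f (vGen K p i) = ω ^ ((i : ZMod p)).val • vGen K p i) :
    (Ip K p f).toSubmodule ⊓ homog K p 1 = ⊥ ∧
    ∀ k : ℕ, 2 ≤ k →
      Module.rank K ((Ip K p f).toSubmodule ⊓ homog K p k : Submodule K (Lp K p))
        ≤ (((k - 1) * (p - 1) ^ (k - 1) : ℕ) : Cardinal) := by
  have hI := Ip_le hω hfa hfv
  have hle : ∀ n : ℕ, (Ip K p f).toSubmodule ⊓ homog K p (n + 1) ≤
      Submodule.span K (zeroPrefixSetOfLength K p n) := fun n =>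
    (inf_le_inf_right _ hI).trans (span_zeroPrefixSet_inf_homog_le n)
  refine ⟨?_, fun k hk => ?_⟩
  · refine eq_bot_iff.2 ((hle 0).trans (Submodule.span_le.2 ?_))
    rintro _ ⟨j, m, i, l, -, hlen, -⟩
    simp at hlen
  · obtain ⟨n, rfl⟩ := Nat.exists_eq_add_of_le' (one_le_two.trans hk)
    exact (Submodule.rank_mono (hle n)).trans
      ((rank_span_le _).trans (mk_zeroPrefixSetOfLength_le n))

end Paper
end
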